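/- arXiv:math/0605550 — 4 statements merged into one kernel-verified Lean document; each statement's English description precedes it below -/
import Mathlib

section
/- A 2×2 complex matrix X satisfies Xᴴ = X and det X = −1 if and only if there exists a matrix F ∈ SL(2,ℂ) such that X = F·e₃·Fᴴ. (Here Xᴴ denotes the conjugate transpose of X.) Consequently, under the identification of ℝ⁴₁ with 2×2 self-adjoint matrices, de Sitter 3-space 𝕊³₁ = {X : Xᴴ = X, det X = −1} equals {F e₃ Fᴴ : F ∈ SL(2,ℂ)}. -/
open Matrix

/-- a 2×2 complex matrix `X` satisfies `Xᴴ = X` and `det X = −1`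
iff `X = F·e₃·Fᴴ` for some `F ∈ SL(2,ℂ)`; i.e. de Sitter 3-space
`{X : Xᴴ = X, det X = −1}` equals `{F e₃ Fᴴ : F ∈ SL(2,ℂ)}`. -/
theorem deSitter_eq_orbit (X : Matrix (Fin 2) (Fin 2) ℂ) :
    (Xᴴ = X ∧ X.det = -1) ↔
      ∃ F : Matrix (Fin 2) (Fin 2) ℂ, F.det = 1 ∧
        X = F * !![(1 : ℂ), 0; 0, -1] * Fᴴ := by
  constructor
  · rintro ⟨hX, hdet⟩
    have ha : star (X 0 0) = X 0 0 := congrFun (congrFun hX 0) 0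
    have hd : star (X 1 1) = X 1 1 := congrFun (congrFun hX 1) 1
    have hb : star (X 0 1) = X 1 0 := congrFun (congrFun hX 1) 0
    have hc : star (X 1 0) = X 0 1 := congrFun (congrFun hX 0) 1
    rw [det_fin_two] at hdet
    rw [eta_fin_two X]
    generalize X 0 0 = a at *
    generalize X 0 1 = b at *
    generalize X 1 0 = c at *
    generalize X 1 1 = d at *
    by_cases h0 : a = 0
    · subst h0
      refine ⟨!![1, -b; c * (d + 1) / 2, (1 - d) / 2], ?_, ?_⟩
      · rw [det_fin_two_of]
        linear_combination (-(d + 1) / 2) * hdet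
      · ext i j
        fin_cases i <;> fin_cases j <;>
          simp [mul_apply, Fin.sum_univ_two, ← starRingEnd_apply] at * <;>
          simp only [hb, hc, hd, map_ofNat]
        all_goals grind
    · refine ⟨!![(a + 1) / 2, (a - 1) / 2;
        ((a - 1) / 2 + (a + 1) / 2 * c) / a, ((a + 1) / 2 + (a - 1) / 2 * c) / a], ?_, ?_⟩
      · rw [det_fin_two_of]
        field_simp
        ring
      · ext i j
        fin_cases i <;> fin_cases j <;>
          simp [mul_apply, Fin.sum_univ_two, ← starRingEnd_apply] at * <;>
          simp only [ha, hc, map_ofNat]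
        all_goals grind
  · rintro ⟨F, hF, rfl⟩
    constructor
    · have he : (!![(1 : ℂ), 0; 0, -1])ᴴ = !![(1 : ℂ), 0; 0, -1] := by
        ext i j
        fin_cases i <;> fin_cases j <;> simp
      rw [conjTranspose_mul, conjTranspose_mul, conjTranspose_conjTranspose, he, mul_assoc]
    · simp [det_mul, det_conjTranspose, hF]
end

section
/- Let Φ ∈ SL(2,ℂ) lie in SU(1,1). Then Φ is conjugate within SU(1,1) to a matrix of (at least) one of the following forms: ℰ = [[e^{iθ},0],[0,e^{−iθ}]] for some θ ∈ [0,2π); or ±ℋ = ±[[cosh s, sinh s],[sinh s, cosh s]] for some s ∈ ℝ∖{0}; or ±𝒫 = ±[[1±i, 1],[1, 1∓i]] (one of the four sign combinations). -/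
open Matrix Complex

/-- The general form of a real multiple of an element of `SU(1,1)`. -/
def suForm (p q : ℂ) : Matrix (Fin 2) (Fin 2) ℂ :=
  !![p, q; (starRingEnd ℂ) q, (starRingEnd ℂ) p]

lemma eq_suForm_of_mem_su11 {Φ : Matrix (Fin 2) (Fin 2) ℂ} (hdet : Φ.det = 1)
    (hΦ : Φᴴ * !![(1 : ℂ), 0; 0, -1] * Φ = !![(1 : ℂ), 0; 0, -1]) :
    Φ = suForm (Φ 0 0) (Φ 0 1) := by
  rw [det_fin_two] at hdet
  have h00 := congrFun (congrFun hΦ 0) 0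
  have h01 := congrFun (congrFun hΦ 0) 1
  simp [Matrix.mul_apply, Fin.sum_univ_two] at h00 h01
  have h1 : Φ 1 1 = (starRingEnd ℂ) (Φ 0 0) := by
    linear_combination (-(Φ 1 1)) * h00 + (starRingEnd ℂ) (Φ 0 0) * hdet + Φ 1 0 * h01
  have h2 : Φ 0 1 = (starRingEnd ℂ) (Φ 1 0) := by
    linear_combination (-(Φ 0 1)) * h00 + (starRingEnd ℂ) (Φ 1 0) * hdet + Φ 0 0 * h01
  ext i j
  fin_cases i <;> fin_cases j <;> simp [suForm, h1, h2]

lemma exists_su11_conj_of_intertwiner {A B : Matrix (Fin 2) (Fin 2) ℂ} (p q : ℂ)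
    (hpos : 0 < normSq p - normSq q) (h : A * suForm p q = suForm p q * B) :
    ∃ U : Matrix (Fin 2) (Fin 2) ℂ, U.det = 1 ∧
      Uᴴ * !![(1 : ℂ), 0; 0, -1] * U = !![(1 : ℂ), 0; 0, -1] ∧ U⁻¹ * A * U = B := by
  set k : ℝ := (√(normSq p - normSq q))⁻¹ with hk
  have hk2 : k * k * (normSq p - normSq q) = 1 := by
    rw [hk, ← mul_inv, Real.mul_self_sqrt hpos.le, inv_mul_cancel₀ hpos.ne']
  have hk2' : (k : ℂ) * k * (p * (starRingEnd ℂ) p - q * (starRingEnd ℂ) q) = 1 := by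
    rw [mul_conj, mul_conj]
    exact_mod_cast hk2
  have hdet : ((k : ℂ) • suForm p q).det = 1 := by
    rw [det_fin_two]
    simp [suForm]
    linear_combination hk2'
  refine ⟨(k : ℂ) • suForm p q, hdet, ?_, ?_⟩
  · ext i j
    fin_cases i <;> fin_cases j <;> simp [suForm, Matrix.mul_apply, Fin.sum_univ_two]
    · linear_combination hk2'
    · ring
    · ring
    · linear_combination -hk2'
  · rw [Matrix.mul_assoc, Matrix.mul_smul, h, ← Matrix.smul_mul,
      Matrix.nonsing_inv_mul_cancel_left _ _ (hdet ▸ isUnit_one)]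

lemma exists_angle {z : ℂ} (hz : normSq z = 1) :
    ∃ θ ∈ Set.Ico (0 : ℝ) (2 * Real.pi),
      Complex.exp (θ * I) = z ∧ Complex.exp (-θ * I) = (starRingEnd ℂ) z := by
  have hn : ‖z‖ = 1 := by
    rw [normSq_eq_norm_sq] at hz
    nlinarith [norm_nonneg z]
  have key : ∃ θ ∈ Set.Ico (0 : ℝ) (2 * Real.pi), Complex.exp (θ * I) = z := by
    have harg : Complex.exp (arg z * I) = z := by
      simpa [hn] using norm_mul_exp_arg_mul_I z
    rcases le_or_gt 0 (arg z) with h | h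
    · exact ⟨arg z, ⟨h, by linarith [arg_le_pi z, Real.pi_pos]⟩, harg⟩
    · refine ⟨arg z + 2 * Real.pi, ⟨by linarith [neg_pi_lt_arg z, Real.pi_pos], by linarith⟩, ?_⟩
      push_cast
      rw [add_mul, Complex.exp_add, exp_two_pi_mul_I, harg, mul_one]
  obtain ⟨θ, hθ, h⟩ := key
  refine ⟨θ, hθ, h, ?_⟩
  rw [← h, ← Complex.exp_conj]
  simp

lemma exists_su11_conj_diagonal {a b : ℂ} (h1 : normSq a - normSq b = 1)
    (h : a.re ^ 2 < 1 ∨ b = 0) :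
    ∃ z : ℂ, normSq z = 1 ∧ ∃ U : Matrix (Fin 2) (Fin 2) ℂ, U.det = 1 ∧
      Uᴴ * !![(1 : ℂ), 0; 0, -1] * U = !![(1 : ℂ), 0; 0, -1] ∧
      U⁻¹ * suForm a b * U = suForm z 0 := by
  by_cases hb : b = 0
  · subst hb
    exact ⟨a, by simpa using h1, exists_su11_conj_of_intertwiner 1 0 (by simp) (by simp [suForm])⟩
  have hx := h.resolve_right hb
  obtain ⟨x, y⟩ := a
  obtain ⟨u, v⟩ := b
  simp only [normSq_mk] at h1 hx
  obtain ⟨m, hm, hmy⟩ : ∃ m : ℝ, m * m = 1 - x ^ 2 ∧ 0 ≤ m * y := by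
    have hs := Real.mul_self_sqrt (show 0 ≤ 1 - x ^ 2 by linarith)
    rcases le_total 0 y with hy | hy
    · exact ⟨√(1 - x ^ 2), hs, by positivity⟩
    · exact ⟨-√(1 - x ^ 2), by linarith, by nlinarith [Real.sqrt_nonneg (1 - x ^ 2)]⟩
  refine ⟨⟨x, m⟩, by simp only [normSq_mk]; linarith,
    exists_su11_conj_of_intertwiner ⟨m + y, 0⟩ ⟨-v, u⟩ ?_ ?_⟩
  · simp only [normSq_mk]
    nlinarith
  · ext i j
    fin_cases i <;> fin_cases j <;> apply Complex.ext <;>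
      simp [suForm, Matrix.mul_apply, Fin.sum_univ_two] <;> linarith

lemma exists_su11_conj_hyperbolic {a b : ℂ} (h1 : normSq a - normSq b = 1) (ha : 1 < a.re) :
    ∃ s : ℝ, s ≠ 0 ∧ ∃ U : Matrix (Fin 2) (Fin 2) ℂ, U.det = 1 ∧
      Uᴴ * !![(1 : ℂ), 0; 0, -1] * U = !![(1 : ℂ), 0; 0, -1] ∧
      U⁻¹ * suForm a b * U = !![(Real.cosh s : ℂ), (Real.sinh s : ℂ);
        (Real.sinh s : ℂ), (Real.cosh s : ℂ)] := by
  obtain ⟨x, y⟩ := a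
  obtain ⟨u, v⟩ := b
  simp only [normSq_mk] at h1 ha
  obtain ⟨s, hc, hsu⟩ : ∃ s : ℝ, Real.cosh s = x ∧ 0 ≤ Real.sinh s * u := by
    have hs := Real.cosh_arcosh ha.le
    have hn := Real.sinh_nonneg_iff.2 (Real.arcosh_nonneg ha.le)
    rcases le_total 0 u with hu | hu
    · exact ⟨Real.arcosh x, hs, by positivity⟩
    · exact ⟨-Real.arcosh x, by simpa using hs, by rw [Real.sinh_neg]; nlinarith⟩
  have hS := Real.cosh_sq s
  have hs0 : s ≠ 0 := by
    rintro rfl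
    simp at hc
    linarith
  rw [hc] at hS
  refine ⟨s, hs0, ?_⟩
  rw [hc]
  generalize Real.sinh s = S at hS hsu
  refine exists_su11_conj_of_intertwiner ⟨u + S, v⟩ ⟨0, y⟩ ?_ ?_
  · simp only [normSq_mk]
    nlinarith
  · ext i j
    fin_cases i <;> fin_cases j <;> apply Complex.ext <;>
      simp [suForm, Matrix.mul_apply, Fin.sum_univ_two] <;> linarith

lemma exists_su11_conj_parabolic {a b : ℂ} (h1 : normSq a - normSq b = 1) (ha : a.re = 1)
    (hb : b ≠ 0) :
    ∃ ε : ℂ, (ε = 1 ∨ ε = -1) ∧ ∃ U : Matrix (Fin 2) (Fin 2) ℂ, U.det = 1 ∧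
      Uᴴ * !![(1 : ℂ), 0; 0, -1] * U = !![(1 : ℂ), 0; 0, -1] ∧
      U⁻¹ * suForm a b * U = !![1 + ε * I, 1; 1, 1 - ε * I] := by
  obtain ⟨x, y⟩ := a
  have hpos := normSq_pos.2 hb
  obtain ⟨u, v⟩ := b
  simp only [normSq_mk] at h1 ha hpos
  subst ha
  obtain ⟨σ, hσ, hy⟩ : ∃ σ : ℝ, (σ = 1 ∨ σ = -1) ∧ 0 < σ * y := by
    rcases lt_trichotomy y 0 with h | h | h
    · exact ⟨-1, Or.inr rfl, by linarith⟩
    · subst h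
      linarith
    · exact ⟨1, Or.inl rfl, by linarith⟩
  have hσ2 : σ * σ = 1 := by rcases hσ with rfl | rfl <;> norm_num
  refine ⟨σ, by rcases hσ with rfl | rfl <;> simp, ?_⟩
  rcases le_or_gt 0 u with hu | hu
  · refine exists_su11_conj_of_intertwiner ⟨-(y + σ), 0⟩ ⟨v, 1 - u⟩ ?_ ?_
    · simp only [normSq_mk]
      nlinarith
    · ext i j
      fin_cases i <;> fin_cases j <;> apply Complex.ext <;>
        simp [suForm, Matrix.mul_apply, Fin.sum_univ_two] <;> linarith
  · refine exists_su11_conj_of_intertwiner ⟨0, y + σ⟩ ⟨u + 1, v⟩ ?_ ?_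
    · simp only [normSq_mk]
      nlinarith
    · ext i j
      fin_cases i <;> fin_cases j <;> apply Complex.ext <;>
        simp [suForm, Matrix.mul_apply, Fin.sum_univ_two] <;> linarith

/-- every element of SU(1,1) is conjugate within SU(1,1) to one of
the normal forms ℰ (elliptic), ±ℋ (hyperbolic) or ±𝒫 (parabolic). -/
theorem su11_normal_forms (Φ : Matrix (Fin 2) (Fin 2) ℂ)
    (hΦdet : Φ.det = 1)
    (hΦ : Φᴴ * !![(1 : ℂ), 0; 0, -1] * Φ = !![(1 : ℂ), 0; 0, -1]) :
    ∃ U : Matrix (Fin 2) (Fin 2) ℂ, U.det = 1 ∧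
      Uᴴ * !![(1 : ℂ), 0; 0, -1] * U = !![(1 : ℂ), 0; 0, -1] ∧
      ((∃ θ ∈ Set.Ico (0 : ℝ) (2 * Real.pi),
          U⁻¹ * Φ * U = !![Complex.exp (θ * I), 0; 0, Complex.exp (-θ * I)]) ∨
       (∃ s : ℝ, s ≠ 0 ∧ ∃ ε : ℂ, (ε = 1 ∨ ε = -1) ∧
          U⁻¹ * Φ * U =
            ε • !![(Real.cosh s : ℂ), (Real.sinh s : ℂ);
                   (Real.sinh s : ℂ), (Real.cosh s : ℂ)]) ∨
       (∃ ε₁ ε₂ : ℂ, (ε₁ = 1 ∨ ε₁ = -1) ∧ (ε₂ = 1 ∨ ε₂ = -1) ∧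
          U⁻¹ * Φ * U = ε₁ • !![1 + ε₂ * I, 1; 1, 1 - ε₂ * I])) := by
  have hform := eq_suForm_of_mem_su11 hΦdet hΦ
  generalize Φ 0 0 = a at hform
  generalize Φ 0 1 = b at hform
  subst hform
  have h1 : normSq a - normSq b = 1 := by
    have h : a * (starRingEnd ℂ) a - b * (starRingEnd ℂ) b = 1 := by
      simpa [suForm, det_fin_two] using hΦdet
    rw [mul_conj, mul_conj] at h
    exact_mod_cast h
  by_cases hell : a.re ^ 2 < 1 ∨ b = 0
  · obtain ⟨z, hz, U, hU, hU', h⟩ := exists_su11_conj_diagonal h1 hell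
    obtain ⟨θ, hθ, hz1, hz2⟩ := exists_angle hz
    exact ⟨U, hU, hU', Or.inl ⟨θ, hθ, by rw [h, hz1, hz2]; simp [suForm]⟩⟩
  push Not at hell
  obtain ⟨hx, hb⟩ := hell
  obtain ⟨ε, hε, a', b', h1', ha', hb', hab⟩ : ∃ ε : ℂ, (ε = 1 ∨ ε = -1) ∧ ∃ a' b' : ℂ,
      normSq a' - normSq b' = 1 ∧ 1 ≤ a'.re ∧ b' ≠ 0 ∧ suForm a b = ε • suForm a' b' := by
    rcases le_total 0 a.re with h | h
    · exact ⟨1, Or.inl rfl, a, b, h1, by nlinarith, hb, by simp⟩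
    · refine ⟨-1, Or.inr rfl, -a, -b, by simpa using h1, ?_, by simpa using hb, by simp [suForm]⟩
      rw [neg_re]
      nlinarith
  rw [hab]
  rcases ha'.lt_or_eq with hlt | heq
  · obtain ⟨s, hs, U, hU, hU', h⟩ := exists_su11_conj_hyperbolic h1' hlt
    exact ⟨U, hU, hU', Or.inr (Or.inl ⟨s, hs, ε, hε, by
      rw [Matrix.mul_smul, Matrix.smul_mul, h]⟩)⟩
  · obtain ⟨δ, hδ, U, hU, hU', h⟩ := exists_su11_conj_parabolic h1' heq.symm hb'
    exact ⟨U, hU, hU', Or.inr (Or.inr ⟨ε, δ, hε, hδ, by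
      rw [Matrix.mul_smul, Matrix.smul_mul, h]⟩)⟩
end

section
/- The map sending a point (x₀,x₁,x₂,x₃) of 𝕊³₁ = {x ∈ ℝ⁴ : −x₀²+x₁²+x₂²+x₃² = 1} to (y₁,y₂,y₃) ∈ ℝ³, where yₖ = (e^{arctan x₀}/√(1+x₀²))·xₖ for k = 1,2,3, is a bijection from 𝕊³₁ onto the hollow ball ℋ = {(y₁,y₂,y₃) ∈ ℝ³ : e^{−π} < y₁²+y₂²+y₃² < e^{π}}. -/
open Real

/-- The conformal factor of the hollow ball map is positive. -/
lemma hollow_ball_factor_pos (t : ℝ) : 0 < exp (arctan t) / √(1 + t ^ 2) := by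
  positivity

/-- The square of the conformal factor, multiplied by `1 + t²`, is `e^{2 arctan t}`. -/
lemma hollow_ball_factor_sq_mul (t : ℝ) :
    (exp (arctan t) / √(1 + t ^ 2)) ^ 2 * (1 + t ^ 2) = exp (2 * arctan t) := by
  have h : 0 < 1 + t ^ 2 := by positivity
  rw [div_pow, sq_sqrt h.le, div_mul_cancel₀ _ h.ne', ← exp_nat_mul, Nat.cast_ofNat]

/-- A de Sitter point with time coordinate `t` is sent to a point of squared norm
`e^{2 arctan t}`. -/
lemma hollow_ball_norm_sq {t a b c : ℝ} (h : -t ^ 2 + a ^ 2 + b ^ 2 + c ^ 2 = 1) :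
    (exp (arctan t) / √(1 + t ^ 2) * a) ^ 2 + (exp (arctan t) / √(1 + t ^ 2) * b) ^ 2 +
      (exp (arctan t) / √(1 + t ^ 2) * c) ^ 2 = exp (2 * arctan t) := by
  rw [← hollow_ball_factor_sq_mul]
  linear_combination (exp (arctan t) / √(1 + t ^ 2)) ^ 2 * h

/-- the map `x ↦ (e^{arctan x₀}/√(1+x₀²))·(x₁,x₂,x₃)` is a
bijection from de Sitter 3-space `𝕊³₁ ⊂ ℝ⁴` onto the hollow ball
`ℋ = {y ∈ ℝ³ : e^{−π} < |y|² < e^{π}}`. -/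
theorem hollow_ball_model_bijective :
    Set.BijOn
      (fun x : Fin 4 → ℝ => fun k : Fin 3 =>
        (Real.exp (Real.arctan (x 0)) / Real.sqrt (1 + (x 0) ^ 2)) * x (k.succ))
      {x : Fin 4 → ℝ | -(x 0) ^ 2 + (x 1) ^ 2 + (x 2) ^ 2 + (x 3) ^ 2 = 1}
      {y : Fin 3 → ℝ |
        Real.exp (-Real.pi) < (y 0) ^ 2 + (y 1) ^ 2 + (y 2) ^ 2 ∧
        (y 0) ^ 2 + (y 1) ^ 2 + (y 2) ^ 2 < Real.exp Real.pi} := by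
  refine ⟨fun x hx => ?_, fun x hx z hz hxz => ?_, fun y hy => ?_⟩
  · have h := hollow_ball_norm_sq hx
    have h1 := neg_pi_div_two_lt_arctan (x 0)
    have h2 := arctan_lt_pi_div_two (x 0)
    change _ < (_ * x 1) ^ 2 + (_ * x 2) ^ 2 + (_ * x 3) ^ 2 ∧
      (_ * x 1) ^ 2 + (_ * x 2) ^ 2 + (_ * x 3) ^ 2 < _
    rw [h, exp_lt_exp, exp_lt_exp]
    constructor <;> linarith
  · have hcoord := congrFun hxz
    have h0 : x 0 = z 0 := by
      have e0 := hcoord 0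
      have e1 := hcoord 1
      have e2 := hcoord 2
      change _ * x 1 = _ * z 1 at e0
      change _ * x 2 = _ * z 2 at e1
      change _ * x 3 = _ * z 3 at e2
      have h := hollow_ball_norm_sq hx
      rw [e0, e1, e2, hollow_ball_norm_sq hz, exp_eq_exp] at h
      exact arctan_injective (by linarith)
    funext i
    refine Fin.cases h0 (fun k => ?_) i
    have hk := hcoord k
    simp only [h0] at hk
    exact mul_left_cancel₀ (hollow_ball_factor_pos (z 0)).ne' hk
  · obtain ⟨hlo, hhi⟩ := hy
    set r := (y 0) ^ 2 + (y 1) ^ 2 + (y 2) ^ 2 with hr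
    have hpos : 0 < r := (exp_pos _).trans hlo
    rw [← lt_log_iff_exp_lt hpos] at hlo
    rw [← log_lt_iff_lt_exp hpos] at hhi
    set t := tan (log r / 2)
    have harctan : arctan t = log r / 2 := arctan_tan (by linarith) (by linarith)
    set c := exp (arctan t) / √(1 + t ^ 2) with hc
    have hcpos : 0 < c := hollow_ball_factor_pos t
    have hcr : c ^ 2 * (1 + t ^ 2) = r := by
      rw [hc, hollow_ball_factor_sq_mul, harctan, mul_div_cancel₀ _ two_ne_zero, exp_log hpos]
    refine ⟨Fin.cons t fun k => y k / c, ?_, ?_⟩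
    · change -t ^ 2 + (y 0 / c) ^ 2 + (y 1 / c) ^ 2 + (y 2 / c) ^ 2 = 1
      field_simp
      linarith
    · funext k
      change c * (y k / c) = y k
      exact mul_div_cancel₀ _ hcpos.ne'
end

section
/- Let ε ∈ {1,−1}, let α, β ∈ ℂ with α·β = −ε/2, and let Φ₁, Φ₂, Φ₃ ∈ SL(2,ℂ). Suppose that P(α,β)⁻¹·Φⱼ·P(α,β) lies in SU(1,1) for j = 1, 2, 3, where P(α,β) = [[α, εβ],[α, −εβ]]. Then there exist real numbers α′, β′ ∈ ℝ with α′·β′ = −ε/2 such that P(α′,β′)⁻¹·Φⱼ·P(α′,β′) lies in SU(1,1) for j = 1, 2, 3. (Indeed, one may take α′ = r and β′ = −ε/(2r) where α = r·e^{iθ} with r > 0.) -/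
open Matrix Complex ComplexConjugate

/-- Preserving a matrix `J` under `X ↦ Xᴴ * J * X` is invariant under conjugation by a unitary
matrix commuting with `J`. -/
lemma conjTranspose_mul_mul_eq_of_unitary_conj {n : Type*} [Fintype n] [DecidableEq n]
    {J P Φ E : Matrix n n ℂ} (hE : Eᴴ * E = 1) (hJ : Commute E J)
    (h : (P⁻¹ * Φ * P)ᴴ * J * (P⁻¹ * Φ * P) = J) :
    ((P * E)⁻¹ * Φ * (P * E))ᴴ * J * ((P * E)⁻¹ * Φ * (P * E)) = J := by
  have hE' : E * Eᴴ = 1 := mul_eq_one_comm.mp hE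
  have hconj : (P * E)⁻¹ * Φ * (P * E) = Eᴴ * (P⁻¹ * Φ * P) * E := by
    rw [Matrix.mul_inv_rev, Matrix.inv_eq_left_inv hE]
    simp only [Matrix.mul_assoc]
  rw [hconj]
  generalize P⁻¹ * Φ * P = M at h
  calc (Eᴴ * M * E)ᴴ * J * (Eᴴ * M * E)
      = Eᴴ * (Mᴴ * (E * J * Eᴴ) * M) * E := by
        simp only [Matrix.conjTranspose_mul, Matrix.conjTranspose_conjTranspose, Matrix.mul_assoc]
    _ = Eᴴ * (Mᴴ * J * M) * E := by
        rw [hJ.eq, Matrix.mul_assoc J, hE', Matrix.mul_one]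
    _ = J := by
        rw [h, Matrix.mul_assoc, ← hJ.eq, ← Matrix.mul_assoc, hE, Matrix.one_mul]

/-- final Lemma of Section 2: if some `α, β ∈ ℂ` with
`αβ = −ε/2` make `P(α,β)⁻¹·Φⱼ·P(α,β) ∈ SU(1,1)` for `j = 1,2,3`, then there
exist real `α′, β′` with `α′β′ = −ε/2` doing the same. -/
theorem real_initial_condition_suffices (ε : ℂ) (hε : ε = 1 ∨ ε = -1)
    (α β : ℂ) (hαβ : α * β = -ε / 2)
    (Φ₁ Φ₂ Φ₃ : Matrix (Fin 2) (Fin 2) ℂ)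
    (hΦ₁ : Φ₁.det = 1) (hΦ₂ : Φ₂.det = 1) (hΦ₃ : Φ₃.det = 1)
    (hsu : ∀ Φ ∈ ({Φ₁, Φ₂, Φ₃} : Set (Matrix (Fin 2) (Fin 2) ℂ)),
      let P : Matrix (Fin 2) (Fin 2) ℂ := !![α, ε * β; α, -(ε * β)]
      (P⁻¹ * Φ * P)ᴴ * !![(1 : ℂ), 0; 0, -1] * (P⁻¹ * Φ * P)
        = !![(1 : ℂ), 0; 0, -1]) :
    ∃ α' β' : ℝ, (α' : ℂ) * (β' : ℂ) = -ε / 2 ∧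
      ∀ Φ ∈ ({Φ₁, Φ₂, Φ₃} : Set (Matrix (Fin 2) (Fin 2) ℂ)),
        let P' : Matrix (Fin 2) (Fin 2) ℂ :=
          !![(α' : ℂ), ε * (β' : ℂ); (α' : ℂ), -(ε * (β' : ℂ))]
        (P'⁻¹ * Φ * P')ᴴ * !![(1 : ℂ), 0; 0, -1] * (P'⁻¹ * Φ * P')
          = !![(1 : ℂ), 0; 0, -1] := by
  have hε0 : ε ≠ 0 := by rcases hε with rfl | rfl <;> norm_num
  have hα : α ≠ 0 := by
    rintro rfl
    apply hε0
    linear_combination 2 * hαβ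
  have hr : (‖α‖ : ℂ) ≠ 0 := by simpa using hα
  have hεre : (ε.re : ℂ) = ε := by rcases hε with rfl | rfl <;> simp
  have hnorm : α * conj α = (‖α‖ : ℂ) ^ 2 := Complex.mul_conj' α
  have hβ : ((-ε.re / (2 * ‖α‖) : ℝ) : ℂ) = β * (α / ‖α‖) := by
    push_cast
    rw [hεre]
    field_simp
    linear_combination -2 * hαβ
  have hα' : (‖α‖ : ℂ) = α * (conj α / ‖α‖) := by
    field_simp
    linear_combination -hnorm
  refine ⟨‖α‖, -ε.re / (2 * ‖α‖), ?_, fun Φ hΦ => ?_⟩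
  · rw [hβ, ← hαβ]
    field_simp
  · set E : Matrix (Fin 2) (Fin 2) ℂ := !![conj α / ‖α‖, 0; 0, α / ‖α‖] with hE_def
    have hE : Eᴴ * E = 1 := by
      have hu : α / ‖α‖ * (conj α / ‖α‖) = 1 := by
        field_simp
        exact hnorm
      ext i j
      fin_cases i <;> fin_cases j <;>
        simp [hE_def, Matrix.mul_apply, Fin.sum_univ_two, hu, mul_comm (conj α / (‖α‖ : ℂ))]
    have hJ : Commute E !![(1 : ℂ), 0; 0, -1] := by
      rw [commute_iff_eq, hE_def]
      simp
    have hP : (!![(‖α‖ : ℂ), ε * ((-ε.re / (2 * ‖α‖) : ℝ) : ℂ);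
        (‖α‖ : ℂ), -(ε * ((-ε.re / (2 * ‖α‖) : ℝ) : ℂ))] : Matrix (Fin 2) (Fin 2) ℂ)
        = !![α, ε * β; α, -(ε * β)] * E := by
      rw [hβ, hE_def]
      simp [← hα', mul_assoc]
    intro P'
    have hP' : P' = !![α, ε * β; α, -(ε * β)] * E := hP
    rw [hP']
    exact conjTranspose_mul_mul_eq_of_unitary_conj hE hJ (hsu Φ hΦ)
end
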